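/- For every θ ∈ (−π/2, π/2), ∫₀^{2π} ρ₀(θ, φ) dφ = −8π²θ / (π² + 4θ²), where ρ₀(θ,φ) = ((π/2 − θ)⁴ sin²φ − (π/2 + θ)⁴ cos²φ) / ((π/2 + θ)⁴ cos²φ + (π/2 − θ)⁴ sin²φ). (This evaluation is used in the proof of Lemma 4.11: since the radial function ρ_M there is independent of φ, the limit of the moment integrand integrates in φ to this closed form.) -/

import Mathlib

open Real MeasureTheory

/-- The pointwise limit `ρ₀` of `ρ_c` as `c → 0⁺`. -/
noncomputable def rho0 (θ φ : ℝ) : ℝ :=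
  ((π/2 - θ)^4 * sin φ ^ 2 - (π/2 + θ)^4 * cos φ ^ 2) /
    ((π/2 + θ)^4 * cos φ ^ 2 + (π/2 - θ)^4 * sin φ ^ 2)

lemma weighted_cos_sq_add_sin_sq_pos {a b : ℝ} (ha : 0 < a) (hb : 0 < b) (x : ℝ) :
    0 < a * cos x ^ 2 + b * sin x ^ 2 := by
  have h := sin_sq_add_cos_sq x
  rcases eq_or_ne (cos x) 0 with hc | hc
  · have hs : sin x ^ 2 = 1 := by simpa [hc] using h
    rw [hc, hs]
    linarith
  · positivity

/-- The derivative of the periodic part of `x ↦ arctan (b / a * tan x)`. -/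
lemma hasDerivAt_arctan_sin_mul_cos_div {a b : ℝ} (ha : 0 < a) (hb : 0 < b) (x : ℝ) :
    HasDerivAt (fun y ↦ arctan ((b - a) * (sin y * cos y) / (a * cos y ^ 2 + b * sin y ^ 2)))
      ((b - a) * (a * cos x ^ 2 - b * sin x ^ 2) / (a ^ 2 * cos x ^ 2 + b ^ 2 * sin x ^ 2)) x := by
  have hE := weighted_cos_sq_add_sin_sq_pos ha hb x
  have hD := weighted_cos_sq_add_sin_sq_pos (pow_pos ha 2) (pow_pos hb 2) x
  have hsc := sin_sq_add_cos_sq x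
  have hnum := ((hasDerivAt_sin x).mul (hasDerivAt_cos x)).const_mul (b - a)
  have hden := (((hasDerivAt_cos x).pow 2).const_mul a).add
    (((hasDerivAt_sin x).pow 2).const_mul b)
  have h := (hnum.div hden hE.ne').arctan
  refine h.congr_deriv ?_
  simp only [Pi.mul_apply, Pi.pow_apply, Pi.add_apply, Pi.div_apply]
  set c := cos x
  set s := sin x
  have hP : (a * c ^ 2 + b * s ^ 2) ^ 2 + ((b - a) * (s * c)) ^ 2 =
      a ^ 2 * c ^ 2 + b ^ 2 * s ^ 2 := by
    linear_combination (a ^ 2 * c ^ 2 + b ^ 2 * s ^ 2) * hsc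
  have hQ : 1 + ((b - a) * (s * c) / (a * c ^ 2 + b * s ^ 2)) ^ 2 =
      (a ^ 2 * c ^ 2 + b ^ 2 * s ^ 2) / (a * c ^ 2 + b * s ^ 2) ^ 2 := by
    rw [← hP]
    field_simp
  rw [hQ]
  field_simp
  push_cast
  linear_combination (b - a) * (a * c ^ 2 - b * s ^ 2) * hsc

lemma integral_weighted_sin_sq_sub_cos_sq_div {a b : ℝ} (ha : 0 < a) (hb : 0 < b) :
    ∫ x in (0 : ℝ)..(2 * π), (b ^ 2 * sin x ^ 2 - a ^ 2 * cos x ^ 2) /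
      (a ^ 2 * cos x ^ 2 + b ^ 2 * sin x ^ 2) = 2 * π * (b - a) / (a + b) := by
  have hD := weighted_cos_sq_add_sin_sq_pos (pow_pos ha 2) (pow_pos hb 2)
  have hint : IntervalIntegrable (fun x ↦ (b ^ 2 * sin x ^ 2 - a ^ 2 * cos x ^ 2) /
      (a ^ 2 * cos x ^ 2 + b ^ 2 * sin x ^ 2)) volume 0 (2 * π) :=
    (Continuous.div (by fun_prop) (by fun_prop) fun x ↦ (hD x).ne').intervalIntegrable _ _
  have hab : a + b ≠ 0 := (add_pos ha hb).ne'
  rcases eq_or_ne a b with rfl | hne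
  · rw [intervalIntegral.integral_eq_sub_of_hasDerivAt (f := fun x ↦ -(sin x * cos x))
      (fun x _ ↦ ?_) hint]
    · simp
    · refine ((hasDerivAt_sin x).mul (hasDerivAt_cos x)).neg.congr_deriv ?_
      rw [eq_div_iff (hD x).ne']
      linear_combination a ^ 2 * (sin x ^ 2 - cos x ^ 2) * sin_sq_add_cos_sq x
  · have hba : b - a ≠ 0 := sub_ne_zero.2 hne.symm
    rw [intervalIntegral.integral_eq_sub_of_hasDerivAt
      (f := fun x ↦ (b - a) / (a + b) * x - 2 * a * b / ((a + b) * (b - a)) *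
        arctan ((b - a) * (sin x * cos x) / (a * cos x ^ 2 + b * sin x ^ 2)))
      (fun x _ ↦ ?_) hint]
    · simp
      ring
    · refine (((hasDerivAt_id x).const_mul _).sub
        ((hasDerivAt_arctan_sin_mul_cos_div ha hb x).const_mul _)).congr_deriv ?_
      have := (hD x).ne'
      field_simp
      ring

/-- For every `θ ∈ (−π/2, π/2)`, `∫₀^{2π} ρ₀(θ, φ) dφ = −8π²θ/(π² + 4θ²)`. -/
theorem stmt_16 (θ : ℝ) (hθ : θ ∈ Set.Ioo (-(π/2)) (π/2)) :
    ∫ φ in (0:ℝ)..(2*π), rho0 θ φ = -(8 * π^2 * θ) / (π^2 + 4*θ^2) := by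
  have h := integral_weighted_sin_sq_sub_cos_sq_div
    (pow_pos (show 0 < π / 2 + θ by linarith [hθ.1]) 2)
    (pow_pos (show 0 < π / 2 - θ by linarith [hθ.2]) 2)
  simp only [← pow_mul, Nat.reduceMul] at h
  simp only [rho0]
  rw [h]
  have hsum : (π / 2 + θ) ^ 2 + (π / 2 - θ) ^ 2 = (π ^ 2 + 4 * θ ^ 2) / 2 := by ring
  rw [hsum]
  have := pi_pos
  field_simp
  ring
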